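/- Under the stated hypotheses (mixed-stopping regime M > √π/(2√r)), the function u satisfies u(p) ≤ M for every p ∈ (0, b]. -/

import Mathlib

/-- The standard normal density `φ(z) = exp(-z²/2)/√(2π)`. -/
noncomputable def npdf (z : ℝ) : ℝ := (Real.sqrt (2 * Real.pi))⁻¹ * Real.exp (-z ^ 2 / 2)

/-- The standard normal distribution function `Φ(y) = ∫_{-∞}^y φ(z) dz`. -/
noncomputable def ncdf (y : ℝ) : ℝ := ∫ z in Set.Iic y, npdf z

/-- The standard normal tail function `Ψ(y) = 1 - Φ(y)`. -/
noncomputable def ntail (y : ℝ) : ℝ := 1 - ncdf y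

/-- The function `F(y) = φ(y) - y·Ψ(y)`. -/
noncomputable def Fstat (y : ℝ) : ℝ := npdf y - y * ntail y

open Filter Topology MeasureTheory in
theorem anti_nonneg (f f' : ℝ → ℝ) (a : ℝ) (hf : ∀ y, HasDerivAt f (f' y) y)
    (hneg : ∀ y, a ≤ y → f' y ≤ 0) (hlim : Tendsto f atTop (𝓝 0)) : ∀ y, a ≤ y → 0 ≤ f y := by
  have hanti : AntitoneOn f (Set.Ici a) := by
    apply antitoneOn_of_deriv_nonpos (convex_Ici a)
    · exact fun y _ => (hf y).continuousAt.continuousWithinAt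
    · exact fun y _ => (hf y).differentiableAt.differentiableWithinAt
    · intro y hy
      rw [interior_Ici] at hy
      rw [(hf y).deriv]
      exact hneg y (le_of_lt hy)
  intro y hy
  refine le_of_tendsto hlim ?_
  filter_upwards [eventually_ge_atTop y] with t ht
  exact hanti hy (hy.trans ht) ht

theorem npdf_pos (y : ℝ) : 0 < npdf y := by
  unfold npdf
  have := Real.pi_pos
  positivity

theorem npdf_deriv (y : ℝ) : HasDerivAt npdf (-y * npdf y) y := by
  unfold npdf
  have h1 : HasDerivAt (fun z : ℝ => -z ^ 2 / 2) (-y) y := by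
    have := ((hasDerivAt_pow 2 y).neg).div_const 2
    refine HasDerivAt.congr_deriv this ?_
    simp
    ring
  have := (h1.exp).const_mul ((Real.sqrt (2 * Real.pi))⁻¹)
  refine HasDerivAt.congr_deriv this ?_
  ring

theorem npdf_eq : npdf = ProbabilityTheory.gaussianPDFReal 0 1 := by
  ext z
  simp [npdf, ProbabilityTheory.gaussianPDFReal]

theorem npdf_integrable : MeasureTheory.Integrable npdf := by
  rw [npdf_eq]; exact ProbabilityTheory.integrable_gaussianPDFReal 0 1

theorem npdf_cont : Continuous npdf :=
  continuous_iff_continuousAt.2 fun y => (npdf_deriv y).continuousAt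

theorem ntail_deriv (y : ℝ) : HasDerivAt ntail (-npdf y) y := by
  have h1 : ∀ t, ncdf t = ncdf 0 + ∫ s in (0:ℝ)..t, npdf s := by
    intro t
    have := intervalIntegral.integral_Iic_sub_Iic (f := npdf) (μ := MeasureTheory.volume)
      (a := 0) (b := t) npdf_integrable.integrableOn npdf_integrable.integrableOn
    unfold ncdf
    linarith
  have h2 : HasDerivAt (fun t => ∫ s in (0:ℝ)..t, npdf s) (npdf y) y :=
    intervalIntegral.integral_hasDerivAt_right (npdf_cont.intervalIntegrable _ _)
      (npdf_cont.stronglyMeasurableAtFilter _ _) npdf_cont.continuousAt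
  have h3 : ntail = fun t => 1 - (ncdf 0 + ∫ s in (0:ℝ)..t, npdf s) := by
    ext t; unfold ntail; rw [h1 t]
  rw [h3]
  exact (h2.const_add _).const_sub 1

open Filter Topology MeasureTheory in
theorem ntail_lim : Tendsto ntail atTop (𝓝 0) := by
  have h := (aecover_Iic (μ := (volume : Measure ℝ)) (tendsto_id (α := ℝ) (x := atTop))).integral_tendsto_of_countably_generated
    npdf_integrable
  have h1 : ∫ z, npdf z = 1 := by
    rw [npdf_eq]; exact ProbabilityTheory.integral_gaussianPDFReal_eq_one 0 one_ne_zero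
  rw [h1] at h
  have := h.const_sub 1
  rw [sub_self] at this
  exact this

theorem ntail_strictAnti : StrictAnti ntail := by
  apply strictAnti_of_deriv_neg
  intro y
  rw [(ntail_deriv y).deriv]
  linarith [npdf_pos y]

theorem ntail_pos (y : ℝ) : 0 < ntail y := by
  have h := anti_nonneg ntail _ (y+1) ntail_deriv (fun t _ => by linarith [npdf_pos t]) ntail_lim (y+1) le_rfl
  exact h.trans_lt (ntail_strictAnti (by linarith))

open Filter Topology in
theorem pow_npdf_lim (k : ℕ) : Tendsto (fun y => y ^ k * npdf y) atTop (𝓝 0) := by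
  have h := (Real.tendsto_pow_mul_exp_neg_atTop_nhds_zero k).const_mul ((Real.sqrt (2 * Real.pi))⁻¹)
  rw [mul_zero] at h
  refine squeeze_zero' ?_ ?_ h
  · filter_upwards [eventually_ge_atTop 0] with y hy
    have := npdf_pos y
    positivity
  · filter_upwards [eventually_ge_atTop 2] with y hy
    unfold npdf
    have h1 : Real.exp (-y ^ 2 / 2) ≤ Real.exp (-y) := Real.exp_le_exp.2 (by nlinarith)
    have h2 : 0 ≤ y ^ k * (Real.sqrt (2 * Real.pi))⁻¹ := by positivity
    nlinarith [mul_le_mul_of_nonneg_left h1 h2]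

open Filter Topology in
theorem npdf_lim : Tendsto npdf atTop (𝓝 0) := by
  simpa using pow_npdf_lim 0

theorem ntail_le (y : ℝ) (hy : 1 ≤ y) : ntail y ≤ npdf y := by
  have h := anti_nonneg (fun y => npdf y - ntail y) _ 1
    (fun t => (npdf_deriv t).sub (ntail_deriv t))
    (fun t ht => by nlinarith [npdf_pos t]) (by simpa using npdf_lim.sub ntail_lim) y hy
  simpa using h

open Filter Topology in
theorem pow_ntail_lim (k : ℕ) : Tendsto (fun y => y ^ k * ntail y) atTop (𝓝 0) := by
  refine squeeze_zero' ?_ ?_ (pow_npdf_lim k)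
  · filter_upwards [eventually_ge_atTop 0] with y hy
    have := ntail_pos y
    positivity
  · filter_upwards [eventually_ge_atTop 1] with y hy
    have : 0 ≤ y ^ k := by positivity
    exact mul_le_mul_of_nonneg_left (ntail_le y hy) this

theorem Fstat_deriv (y : ℝ) : HasDerivAt Fstat (-ntail y) y := by
  unfold Fstat
  have := (npdf_deriv y).sub ((hasDerivAt_id y).mul (ntail_deriv y))
  refine HasDerivAt.congr_deriv this ?_
  simp only [id]
  ring

open Filter Topology in
theorem Fstat_lim : Tendsto Fstat atTop (𝓝 0) := by
  have := npdf_lim.sub (pow_ntail_lim 1)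
  simp only [sub_zero, pow_one] at this
  exact this

theorem Fstat_nonneg (y : ℝ) : 0 ≤ Fstat y :=
  anti_nonneg Fstat _ y Fstat_deriv (fun t _ => by linarith [ntail_pos t]) Fstat_lim y le_rfl

theorem P_nonneg (y : ℝ) : 0 ≤ ntail y - y * Fstat y := by
  refine anti_nonneg (fun y => ntail y - y * Fstat y) (fun t => -2 * Fstat t) y
    (fun t => ?_) (fun t _ => by linarith [Fstat_nonneg t]) ?_ y le_rfl
  · have := (ntail_deriv t).sub ((hasDerivAt_id t).mul (Fstat_deriv t))
    refine HasDerivAt.congr_deriv this ?_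
    simp only [id, Fstat]
    ring
  · have := (ntail_lim.sub (pow_npdf_lim 1)).add (pow_ntail_lim 2)
    simp only [sub_zero, add_zero] at this
    refine this.congr fun t => ?_
    simp only [Fstat]; ring

theorem K_nonneg (y : ℝ) : 0 ≤ ntail y ^ 2 - npdf y * Fstat y := by
  refine anti_nonneg (fun y => ntail y ^ 2 - npdf y * Fstat y)
    (fun t => - (npdf t * (ntail t - t * Fstat t))) y
    (fun t => ?_) (fun t _ => ?_) ?_ y le_rfl
  · have := ((ntail_deriv t).pow 2).sub ((npdf_deriv t).mul (Fstat_deriv t))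
    refine HasDerivAt.congr_deriv this ?_
    simp
    ring
  · have := mul_nonneg (npdf_pos t).le (P_nonneg t)
    linarith
  · simpa using (ntail_lim.pow 2).sub (npdf_lim.mul Fstat_lim)

theorem ratio_anti : Antitone (fun y => Fstat y / ntail y) := by
  have hd : ∀ y, HasDerivAt (fun y => Fstat y / ntail y) _ y := fun y =>
    (Fstat_deriv y).div (ntail_deriv y) (ntail_pos y).ne'
  apply antitone_of_deriv_nonpos
  · exact fun y => (hd y).differentiableAt
  · intro y
    rw [(hd y).deriv]
    apply div_nonpos_of_nonpos_of_nonneg _ (by positivity)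
    nlinarith [K_nonneg y]

theorem antiOn_of (f f' : ℝ → ℝ) (a : ℝ) (hf : ∀ y, HasDerivAt f (f' y) y)
    (hneg : ∀ y, a ≤ y → f' y ≤ 0) (y : ℝ) (hy : a ≤ y) : f y ≤ f a := by
  have hanti : AntitoneOn f (Set.Ici a) := by
    apply antitoneOn_of_deriv_nonpos (convex_Ici a)
    · exact fun y _ => (hf y).continuousAt.continuousWithinAt
    · exact fun y _ => (hf y).differentiableAt.differentiableWithinAt
    · intro y hy
      rw [interior_Ici] at hy
      rw [(hf y).deriv]
      exact hneg y (le_of_lt hy)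
  exact hanti (Set.mem_Ici.2 le_rfl) hy hy

theorem H_le (x y m : ℝ) (hd : (m - x) * Fstat x = ntail x) (hxy : x ≤ y) :
    npdf y * (m - y) / ntail y ≤ npdf x * (m - x) / ntail x := by
  have hdd : ∀ y, HasDerivAt (fun y => npdf y * (m - y) / ntail y)
      (npdf y * ((m - y) * Fstat y - ntail y) / ntail y ^ 2) y := by
    intro y
    have := ((npdf_deriv y).mul ((hasDerivAt_id y).const_sub m)).div (ntail_deriv y) (ntail_pos y).ne'
    refine HasDerivAt.congr_deriv this ?_
    simp only [id, Fstat, Pi.mul_apply]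
    ring
  refine antiOn_of (fun y => npdf y * (m - y) / ntail y) _ x hdd (fun t ht => ?_) y hxy
  apply div_nonpos_of_nonpos_of_nonneg _ (by positivity)
  apply mul_nonpos_of_nonneg_of_nonpos (npdf_pos t).le
  rcases le_total m t with h | h
  · nlinarith [Fstat_nonneg t, ntail_pos t, mul_nonneg (sub_nonneg.2 h) (Fstat_nonneg t)]
  · have h1 := ratio_anti ht
    simp only at h1
    rw [div_le_div_iff₀ (ntail_pos t) (ntail_pos x)] at h1
    have h2 : (m - t) * Fstat t ≤ (m - x) * Fstat t :=
      mul_le_mul_of_nonneg_right (by linarith) (Fstat_nonneg t)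
    have h3 : (m - x) * (Fstat t * ntail x) ≤ (m - x) * (Fstat x * ntail t) :=
      mul_le_mul_of_nonneg_left h1 (by linarith)
    have h4 : ((m - x) * Fstat t) * ntail x ≤ ntail t * ntail x := by
      rw [← hd] at h3 ⊢; nlinarith
    have := le_of_mul_le_mul_right h4 (ntail_pos x)
    linarith

theorem core (x y m b : ℝ) (hd : (m - x) * Fstat x = ntail x) (hxy : x ≤ y)
    (hb : 2 * b * npdf x = m * ntail x) (hb0 : 0 < b) :
    b * ntail y * (y - m) * Fstat x + (m - b * x) * Fstat y * ntail x
      ≤ m * (1 - b) * Fstat x * ntail x := by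
  have hΨ := ntail_pos x
  have hF : 0 < Fstat x := by
    rcases (Fstat_nonneg x).eq_or_lt with h | h
    · rw [← h] at hd; simp at hd; linarith
    · exact h
  have hrel : 2 * b * (1 + x * (m - x)) = m * (m - x) := by
    have h1 : npdf x = Fstat x + x * ntail x := by unfold Fstat; ring
    rw [h1, ← hd] at hb
    apply mul_right_cancel₀ hF.ne'
    linarith
  have hdd : ∀ y, HasDerivAt (fun y => b * ntail y * (y - m) * Fstat x + (m - b * x) * Fstat y * ntail x)
      (b * Fstat x * (ntail y + npdf y * (m - y)) - (m - b * x) * ntail y * ntail x) y := by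
    intro y
    have := ((((ntail_deriv y).const_mul b).mul ((hasDerivAt_id y).sub_const m)).mul_const (Fstat x)).add
      (((Fstat_deriv y).const_mul (m - b * x)).mul_const (ntail x))
    refine HasDerivAt.congr_deriv this ?_
    simp only [id]
    ring
  have h := antiOn_of _ _ x hdd (fun t ht => ?_) y hxy
  · refine h.trans (le_of_eq ?_)
    ring
  · have h1 := H_le x t m hd ht
    rw [div_le_iff₀ (ntail_pos t)] at h1
    have h2 : b * (npdf t * (m - t)) ≤ b * (npdf x * (m - x) / ntail x * ntail t) :=
      mul_le_mul_of_nonneg_left h1 hb0.le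
    have h3 : b * (npdf x * (m - x) / ntail x * ntail t) = m * (m - x) / 2 * ntail t := by
      have : b * npdf x = m * ntail x / 2 := by linarith
      calc _ = (b * npdf x) * (m - x) / ntail x * ntail t := by ring
        _ = _ := by rw [this]; field_simp
    rw [h3] at h2
    have h4 : b * (ntail t + npdf t * (m - t)) - (m - b * x) * (m - x) * ntail t ≤ 0 := by
      have : b * ntail t + m * (m - x) / 2 * ntail t - (m - b * x) * (m - x) * ntail t = 0 := by
        linear_combination (ntail t / 2) * hrel
      linarith
    have h5 := mul_nonpos_of_nonneg_of_nonpos hF.le h4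
    have h6 : b * Fstat x * (ntail t + npdf t * (m - t)) - (m - b * x) * ntail t * ntail x
      = Fstat x * (b * (ntail t + npdf t * (m - t)) - (m - b * x) * (m - x) * ntail t) := by
      linear_combination ((m - b * x) * ntail t) * hd
    rw [h6]; exact h5

/-- in the mixed-stopping regime M > √π/(2√r), with z > 0 solving
√(2r)(M−z)F(√(2r)z) = Ψ(√(2r)z), b = √r·M·Ψ(√(2r)z)/(√2·φ(√(2r)z)) < 1, v solving
Ψ(√(2r)v(p)) = ((1−b)p/(b(1−p)))·Ψ(√(2r)z) on (0,b], and
u(p) = p·v(p) + (M − b·z)·((1−p)F(√(2r)v(p)))/((1−b)F(√(2r)z)),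
one has u(p) ≤ M for every p ∈ (0,b]. -/
theorem u_le_M_mixed (r M z b : ℝ) (v u : ℝ → ℝ) (hr : 0 < r)
    (hM : Real.sqrt Real.pi / (2 * Real.sqrt r) < M) (hz : 0 < z)
    (heq : Real.sqrt (2*r) * (M - z) * Fstat (Real.sqrt (2*r) * z)
      = ntail (Real.sqrt (2*r) * z))
    (hb : b = Real.sqrt r * M * ntail (Real.sqrt (2*r) * z)
      / (Real.sqrt 2 * npdf (Real.sqrt (2*r) * z)))
    (hb1 : b < 1)
    (hv : ∀ p ∈ Set.Ioc (0:ℝ) b, 0 < v p ∧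
      ntail (Real.sqrt (2*r) * v p)
        = ((1 - b) * p / (b * (1 - p))) * ntail (Real.sqrt (2*r) * z))
    (hu : ∀ p ∈ Set.Ioc (0:ℝ) b, u p =
      p * v p + (M - b * z) * ((1 - p) * Fstat (Real.sqrt (2*r) * v p))
        / ((1 - b) * Fstat (Real.sqrt (2*r) * z))) :
    ∀ p ∈ Set.Ioc (0:ℝ) b, u p ≤ M := by
  intro p hp
  obtain ⟨hv0, hvp⟩ := hv p hp
  rw [hu p hp]
  obtain ⟨hp0, hpb⟩ := hp
  have hb0 : 0 < b := hp0.trans_le hpb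
  have hs : 0 < Real.sqrt (2*r) := Real.sqrt_pos.2 (by linarith)
  have hsr : Real.sqrt (2*r) = Real.sqrt 2 * Real.sqrt r := Real.sqrt_mul (by norm_num) r
  have h22 : Real.sqrt 2 * Real.sqrt 2 = 2 := Real.mul_self_sqrt (by norm_num)
  have h2p : 0 < Real.sqrt 2 := by positivity
  set s := Real.sqrt (2*r) with hsdef
  have hp1 : 0 < 1 - p := by linarith
  have hb1' : 0 < 1 - b := by linarith
  have hΨ := ntail_pos (s * z)
  have hφ := npdf_pos (s * z)
  have hd : (s * M - s * z) * Fstat (s * z) = ntail (s * z) := by rw [← heq]; ring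
  have hF : 0 < Fstat (s * z) := by
    rcases (Fstat_nonneg (s * z)).eq_or_lt with h | h
    · rw [← h] at hd; simp at hd; linarith
    · exact h
  have hbm : 2 * b * npdf (s * z) = (s * M) * ntail (s * z) := by
    rw [eq_div_iff (by positivity)] at hb
    linear_combination Real.sqrt 2 * hb - b * npdf (s * z) * h22 - M * ntail (s * z) * hsr
  have hxy : s * z ≤ s * v p := by
    apply ntail_strictAnti.le_iff_ge.1
    rw [hvp]
    have : (1 - b) * p / (b * (1 - p)) ≤ 1 := by
      rw [div_le_one (by positivity)]
      nlinarith
    nlinarith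
  have hc := core (s * z) (s * v p) (s * M) b hd hxy hbm hb0
  have hvp' : b * (1 - p) * ntail (s * v p) = (1 - b) * p * ntail (s * z) := by
    rw [hvp]; field_simp
  have hle : (M - b * z) * ((1 - p) * Fstat (s * v p)) ≤ (M - p * v p) * ((1 - b) * Fstat (s * z)) := by
    have h1 := mul_le_mul_of_nonneg_left hc hp1.le
    have hpos : 0 < s * ntail (s * z) := by positivity
    refine le_of_mul_le_mul_right ?_ hpos
    linear_combination h1 - (s * (v p - M)) * Fstat (s * z) * hvp'
  have := (div_le_iff₀ (by positivity)).2 hle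
  linarith
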